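/- For every n ≥ 1, the single-variable specialization v = 0 of the generating polynomial satisfies (n!)² · P_n(u,0) = u · ∏_{i=1}^{n−1} ( u + i(i+1) ) in ℚ[u]; equivalently, P_n(u,0) = (u/n) ∏_{i=1}^{n−1} ( u/(i(i+1)) + 1 ). -/

import Mathlib

open Finset MvPolynomial

/-- Product of left partial sums of a list of parts (as a rational number). -/
noncomputable def Lval (p : List ℕ) : ℚ :=
  ∏ j ∈ Finset.range p.length, (((p.take (j + 1)).sum : ℕ) : ℚ)

/-- Product of right partial sums. -/
noncomputable def Rval (p : List ℕ) : ℚ := Lval p.reverse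

/-- `S k l n`: the sum over all `l`-compositions `p` of `n` of `e_k(p)/(L(p)R(p))`. -/
noncomputable def Sval (k l n : ℕ) : ℚ :=
  ∑ c ∈ Finset.univ.filter (fun c : Composition n => c.length = l),
    ((c.blocks.map (fun i : ℕ => (i : ℚ)) : Multiset ℚ).esymm k) /
      (Lval c.blocks * Rval c.blocks)

/-- The generating polynomial `P_n(u,v)` in `ℚ[u,v]`, with `X 0 = u`, `X 1 = v`. -/
noncomputable def Pgen (n : ℕ) : MvPolynomial (Fin 2) ℚ :=
  ∑ l ∈ Finset.Icc 1 n, ∑ k ∈ Finset.range (l + 1),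
    C (Sval k l n) * X 0 ^ k * X 1 ^ (l - k)

/-- The weight `∏ᵢ u pᵢ / ((pᵢ + ⋯ + p_l) (n - (pᵢ₊₁ + ⋯ + p_l)))` of a list of parts. -/
noncomputable def compositionWeight (u : ℚ) (n : ℕ) : List ℕ → ℚ
  | [] => 1
  | a :: p => u * a / (((a + p.sum : ℕ) : ℚ) * ((n : ℚ) - (p.sum : ℚ))) * compositionWeight u n p

lemma Rval_cons (a : ℕ) (p : List ℕ) : Rval (a :: p) = Rval p * ((a + p.sum : ℕ) : ℚ) := by
  unfold Rval Lval
  rw [List.reverse_cons, List.length_append, List.length_singleton, Finset.prod_range_succ]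
  congr 1
  · refine Finset.prod_congr rfl fun j hj => ?_
    rw [List.take_append_of_le_length (Nat.succ_le_of_lt (Finset.mem_range.mp hj))]
  · rw [List.take_of_length_le (by simp)]
    simp [add_comm]

lemma compositionWeight_mul_offset (u : ℚ) (n : ℕ) (p : List ℕ) (s : ℕ)
    (hp : ∀ i ∈ p, 0 < i) (hs : s + p.sum = n) :
    compositionWeight u n p *
        ((∏ j ∈ Finset.range p.length, ((s + (p.take (j + 1)).sum : ℕ) : ℚ)) * Rval p) =
      u ^ p.length * (p.map (fun i : ℕ => (i : ℚ))).prod := by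
  induction p generalizing s with
  | nil => simp [compositionWeight, Rval, Lval]
  | cons a p ih =>
    have ha : 0 < a := hp a (by simp)
    have key := ih (s + a) (fun i hi => hp i (by simp [hi])) (by simp at hs; omega)
    have hn : (n : ℚ) - (p.sum : ℚ) = (s : ℚ) + a := by
      rw [← hs]; simp; ring
    have h1 : (s : ℚ) + a ≠ 0 := by positivity
    have h2 : ((a + p.sum : ℕ) : ℚ) ≠ 0 := by positivity
    rw [Rval_cons, compositionWeight, hn, List.length_cons, Finset.prod_range_succ', List.map_cons,
      List.prod_cons, pow_succ]
    simp only [List.take_succ_cons, List.sum_cons, List.take_zero, List.sum_nil, ← add_assoc,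
      add_zero] at key ⊢
    calc _ = u * a * (compositionWeight u n p * ((∏ j ∈ Finset.range p.length,
          ((s + a + (p.take (j + 1)).sum : ℕ) : ℚ)) * Rval p)) := by
          push_cast at h2 ⊢
          field_simp
      _ = _ := by rw [key]; ring

lemma Lval_pos (p : List ℕ) (hp : ∀ i ∈ p, 0 < i) : 0 < Lval p := by
  refine Finset.prod_pos fun j hj => ?_
  rcases p with _ | ⟨a, p⟩
  · simp at hj
  · have := hp a (by simp)
    simp only [List.take_succ_cons, List.sum_cons]
    positivity

lemma compositionWeight_blocks (u : ℚ) {n : ℕ} (c : Composition n) :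
    compositionWeight u n c.blocks =
      (c.blocks.map (fun i : ℕ => (i : ℚ))).prod / (Lval c.blocks * Rval c.blocks)
        * u ^ c.length := by
  have hL := Lval_pos c.blocks fun i hi => c.blocks_pos hi
  have hR : 0 < Rval c.blocks := Lval_pos c.blocks.reverse fun i hi =>
    c.blocks_pos (List.mem_reverse.mp hi)
  have h := compositionWeight_mul_offset u n c.blocks 0 (fun i hi => c.blocks_pos hi) (by simp)
  simp only [zero_add] at h
  rw [div_mul_eq_mul_div, eq_div_iff (by positivity), mul_comm _ (u ^ _)]
  exact h

/-- Summing over compositions by splitting off the first block. -/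
lemma Composition.sum_succ {M : Type*} [AddCommMonoid M] (t : ℕ) (F : List ℕ → M) :
    ∑ c : Composition (t + 1), F c.blocks =
      ∑ j ∈ Finset.range (t + 1), ∑ c : Composition j, F ((t + 1 - j) :: c.blocks) := by
  rw [Finset.sum_sigma']
  symm
  refine Finset.sum_bij
    (fun x hx => ⟨(t + 1 - x.1) :: x.2.blocks, ?_, ?_⟩) ?_ ?_ ?_ ?_
  · have hx' : x.1 < t + 1 := by simpa using hx
    intro i hi
    rcases List.mem_cons.mp hi with rfl | hi
    · omega
    · exact x.2.blocks_pos hi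
  · have hx' : x.1 < t + 1 := by simpa using hx
    simp; omega
  · simp
  · rintro ⟨j, c⟩ hj ⟨k, d⟩ hk h
    simp only [Composition.mk.injEq, List.cons.injEq] at h
    obtain rfl : j = k := by rw [← c.blocks_sum, ← d.blocks_sum, h.2]
    rw [Composition.ext h.2]
  · rintro ⟨b, hb, hsum⟩ -
    rcases b with _ | ⟨a, b⟩
    · simp at hsum
    · have ha : 0 < a := hb (by simp)
      have hab : a + b.sum = t + 1 := by simpa using hsum
      refine ⟨⟨b.sum, ⟨b, fun hi => hb (by simp [hi]), rfl⟩⟩, ?_, ?_⟩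
      · simp; omega
      · simp only [Composition.mk.injEq, List.cons.injEq, and_true]
        omega
  · intros; rfl

/-- The total `compositionWeight` of the compositions of `t`. -/
noncomputable def weightSum (u : ℚ) (n t : ℕ) : ℚ :=
  ∑ c : Composition t, compositionWeight u n c.blocks

lemma weightSum_zero (u : ℚ) (n : ℕ) : weightSum u n 0 = 1 := by
  have (c : Composition 0) : compositionWeight u n c.blocks = 1 := by
    rw [List.eq_nil_of_length_eq_zero (Nat.le_zero.mp c.length_le), compositionWeight]
  simp [weightSum, this, composition_card]

lemma succ_mul_weightSum_succ (u : ℚ) (n t : ℕ) :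
    ((t : ℚ) + 1) * weightSum u n (t + 1) =
      u * ∑ j ∈ Finset.range (t + 1), ((t : ℚ) + 1 - j) * (weightSum u n j / ((n : ℚ) - j)) := by
  rw [weightSum, Composition.sum_succ, Finset.mul_sum, Finset.mul_sum]
  refine Finset.sum_congr rfl fun j hj => ?_
  have hj : j ≤ t + 1 := (Finset.mem_range.mp hj).le
  simp only [compositionWeight, Composition.blocks_sum, Nat.sub_add_cancel hj]
  rw [← Finset.mul_sum, ← weightSum]
  push_cast [hj]
  have : (t : ℚ) + 1 ≠ 0 := by positivity
  rw [← mul_div_mul_left _ ((n : ℚ) - j) this]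
  field_simp

/-- Newton coefficients of the solution `K` of the difference equation
`m (n - m) (K (m + 1) - 2 K m + K (m - 1)) = u K m`. -/
noncomputable def newtonCoeff (u : ℚ) (n k : ℕ) : ℚ :=
  ∏ j ∈ Finset.range k, (u + j * (j + 1)) / (((j : ℚ) + 1) * ((n : ℚ) - j - 1))

/-- The solution of the difference equation, in the Newton basis. -/
noncomputable def newtonSum (u : ℚ) (n m : ℕ) : ℚ :=
  ∑ k ∈ Finset.range n, newtonCoeff u n k * (m.choose (k + 1) : ℚ)

lemma cast_choose_succ_mul (m k : ℕ) :
    (m.choose (k + 1) : ℚ) * (k + 1) = m.choose k * ((m : ℚ) - k) := by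
  rcases le_or_gt k m with h | h
  · have := Nat.choose_succ_right_eq m k
    have h2 := congrArg (Nat.cast : ℕ → ℚ) this
    push_cast [h] at h2
    exact h2
  · rw [Nat.choose_eq_zero_of_lt h, Nat.choose_eq_zero_of_lt (by omega)]
    simp

lemma newtonCoeff_succ_mul (u : ℚ) {n k : ℕ} (hk : k + 1 < n) :
    newtonCoeff u n (k + 1) * (((k : ℚ) + 1) * ((n : ℚ) - k - 1)) =
      newtonCoeff u n k * (u + k * (k + 1)) := by
  have h : ((k : ℚ) + 1) < n := by exact_mod_cast hk
  have h1 : ((n : ℚ) - k - 1) ≠ 0 := by linarith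
  rw [newtonCoeff, Finset.prod_range_succ, ← newtonCoeff]
  field_simp

lemma newtonSum_second_difference (u : ℚ) {n t : ℕ} (ht : t + 1 < n) :
    ((t : ℚ) + 1) * ((n : ℚ) - t - 1) *
        (newtonSum u n (t + 2) - 2 * newtonSum u n (t + 1) + newtonSum u n t) =
      u * newtonSum u n (t + 1) := by
  let E : ℕ → ℚ := fun k => newtonCoeff u n k * k * ((n : ℚ) - k) * ((t + 1).choose k : ℚ)
  rw [← sub_eq_zero]
  have hE : ∑ k ∈ Finset.range n, (E k - E (k + 1)) = 0 := by
    rw [Finset.sum_range_sub']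
    simp [E]
  rw [← hE]
  simp only [newtonSum, Finset.mul_sum, ← Finset.sum_sub_distrib, ← Finset.sum_add_distrib]
  refine Finset.sum_congr rfl fun k hk => ?_
  have hsucc : E (k + 1) =
      newtonCoeff u n k * (u + k * (k + 1)) * ((t + 1).choose (k + 1) : ℚ) := by
    rcases Nat.lt_or_ge (k + 1) n with h | h
    · rw [← newtonCoeff_succ_mul u h]
      simp only [E]; push_cast; ring
    · simp only [E]
      rw [Nat.choose_eq_zero_of_lt (by omega : t + 1 < k + 1)]
      simp
  have hdiff : ((t : ℚ) + 1) * (((t + 2).choose (k + 1) : ℚ) - 2 * ((t + 1).choose (k + 1) : ℚ) +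
      (t.choose (k + 1) : ℚ)) = k * ((t + 1).choose k : ℚ) := by
    rcases k with _ | k
    · simp only [zero_add, Nat.choose_one_right]
      push_cast; ring
    · have h := congrArg (Nat.cast : ℕ → ℚ) (Nat.add_one_mul_choose_eq t k)
      rw [Nat.choose_succ_succ' (t + 1) (k + 1), Nat.choose_succ_succ' t (k + 1),
        Nat.choose_succ_succ' t k]
      rw [Nat.choose_succ_succ' t k] at h
      push_cast at h ⊢
      linear_combination h
  have hch := cast_choose_succ_mul (t + 1) k
  push_cast at hch
  rw [hsucc]
  simp only [E]
  linear_combination newtonCoeff u n k * ((n : ℚ) - t - 1) * hdiff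
    + newtonCoeff u n k * k * hch

lemma sum_weightSum_eq_newtonSum (u : ℚ) {n : ℕ} (hn : 1 ≤ n) (t : ℕ) (ht : t ≤ n) :
    n * ∑ j ∈ Finset.range t, ((t : ℚ) - j) * (weightSum u n j / ((n : ℚ) - j)) =
      newtonSum u n t := by
  have hn0 : (n : ℚ) ≠ 0 := by positivity
  induction t using Nat.twoStepInduction with
  | zero => simp [newtonSum]
  | one =>
    obtain ⟨m, rfl⟩ : ∃ m, n = m + 1 := ⟨n - 1, by omega⟩
    rw [newtonSum, Finset.sum_range_succ' _ m]
    have hzero : ∑ k ∈ Finset.range m,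
        newtonCoeff u (m + 1) (k + 1) * (Nat.choose 1 (k + 1 + 1) : ℚ) = 0 :=
      Finset.sum_eq_zero fun k _ => by rw [Nat.choose_eq_zero_of_lt (by omega)]; simp
    rw [hzero]
    simp only [Finset.sum_range_one, weightSum_zero, newtonCoeff, Finset.prod_range_zero,
      Nat.cast_zero, sub_zero, Nat.cast_one, zero_add, Nat.choose_self, one_mul]
    exact mul_one_div_cancel hn0
  | more t ih₀ ih₁ =>
    have h₀ := ih₀ (by omega)
    have h₁ := ih₁ (by omega)
    have hK := newtonSum_second_difference u (n := n) (t := t) (by omega)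
    have hw := succ_mul_weightSum_succ u n t
    have hlt : (t : ℚ) + 1 < n := by exact_mod_cast (show t + 1 < n by omega)
    have hc : ((t : ℚ) + 1) * ((n : ℚ) - t - 1) ≠ 0 :=
      mul_ne_zero (by positivity) (by linarith)
    set G : ℕ → ℚ := fun j => weightSum u n j / ((n : ℚ) - j) with hG
    have hG1 : G (t + 1) * ((n : ℚ) - t - 1) = weightSum u n (t + 1) := by
      simp only [hG]; push_cast
      rw [← sub_sub]
      exact div_mul_cancel₀ _ (by linarith)
    have hsum : ∑ j ∈ Finset.range (t + 2), (((t + 2 : ℕ) : ℚ) - j) * G j =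
        2 * ∑ j ∈ Finset.range (t + 1), (((t + 1 : ℕ) : ℚ) - j) * G j
          - ∑ j ∈ Finset.range t, ((t : ℚ) - j) * G j + G (t + 1) := by
      simp only [Finset.sum_range_succ]
      have : ∑ j ∈ Finset.range t, (((t + 2 : ℕ) : ℚ) - j) * G j =
          2 * ∑ j ∈ Finset.range t, (((t + 1 : ℕ) : ℚ) - j) * G j
          - ∑ j ∈ Finset.range t, ((t : ℚ) - j) * G j := by
        rw [Finset.mul_sum, ← Finset.sum_sub_distrib]
        exact Finset.sum_congr rfl fun j _ => by push_cast; ring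
      rw [this]; push_cast; ring
    change n * ∑ j ∈ Finset.range t, ((t : ℚ) - j) * G j = _ at h₀
    change n * ∑ j ∈ Finset.range (t + 1), (((t + 1 : ℕ) : ℚ) - j) * G j = _ at h₁
    change _ = u * ∑ j ∈ Finset.range (t + 1), ((t : ℚ) + 1 - j) * G j at hw
    change n * ∑ j ∈ Finset.range (t + 2), (((t + 2 : ℕ) : ℚ) - j) * G j = _
    rw [hsum]
    push_cast at h₁ ⊢
    apply mul_left_cancel₀ hc
    rw [← hG1] at hw
    linear_combination (2 * (((t : ℚ) + 1) * ((n : ℚ) - t - 1)) + u) * h₁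
      - ((t : ℚ) + 1) * ((n : ℚ) - t - 1) * h₀ - hK + n * hw

lemma newtonCoeff_mul_choose (u : ℚ) {n k : ℕ} (hk : k < n) :
    newtonCoeff u n k * (n.choose (k + 1) : ℚ) =
      n * ∏ j ∈ Finset.range k, (u + j * (j + 1)) / (((j : ℚ) + 1) * (j + 2)) := by
  induction k with
  | zero => simp [newtonCoeff]
  | succ k ih =>
    have h := ih (by omega)
    have hlt : (k : ℚ) + 1 < n := by exact_mod_cast hk
    have h1 : (n : ℚ) - k - 1 ≠ 0 := by linarith
    have hch := cast_choose_succ_mul n (k + 1)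
    push_cast at hch
    have hch' : (n.choose (k + 1 + 1) : ℚ) = n.choose (k + 1) * ((n : ℚ) - k - 1) / (k + 2) := by
      rw [eq_div_iff (by positivity)]; linear_combination hch
    rw [newtonCoeff, Finset.prod_range_succ, ← newtonCoeff, Finset.prod_range_succ, hch',
      ← mul_assoc (n : ℚ), ← h]
    field_simp

lemma prod_range_succ_ratio (u : ℚ) (N : ℕ) :
    ∏ j ∈ Finset.range (N + 1), (u + j * (j + 1)) / (((j : ℚ) + 1) * (j + 2)) =
      u / (((N : ℚ) + 1) * (N + 2)) *
        ∏ i ∈ Finset.range N, (u + (i + 1) * (i + 2)) / (((i : ℚ) + 1) * (i + 2)) := by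
  induction N with
  | zero => simp
  | succ N ih =>
    rw [Finset.prod_range_succ, ih, Finset.prod_range_succ]
    push_cast
    field_simp
    ring

lemma sum_prod_ratio (u : ℚ) (N : ℕ) :
    ∑ k ∈ Finset.range (N + 1),
        ∏ j ∈ Finset.range k, (u + j * (j + 1)) / (((j : ℚ) + 1) * (j + 2)) =
      ∏ i ∈ Finset.range N, (u + (i + 1) * (i + 2)) / (((i : ℚ) + 1) * (i + 2)) := by
  induction N with
  | zero => simp
  | succ N ih =>
    rw [Finset.sum_range_succ, ih, prod_range_succ_ratio, Finset.prod_range_succ]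
    field_simp
    ring

lemma factorial_sq_mul_prod_ratio (u : ℚ) (N : ℕ) :
    ((N + 1).factorial : ℚ) ^ 2 *
        ∏ i ∈ Finset.range N, (u + (i + 1) * (i + 2)) / (((i : ℚ) + 1) * (i + 2)) =
      ((N : ℚ) + 1) * ∏ i ∈ Finset.range N, (u + (i + 1) * (i + 2)) := by
  induction N with
  | zero => simp
  | succ N ih =>
    rw [Finset.prod_range_succ, Finset.prod_range_succ, Nat.factorial_succ]
    push_cast at ih ⊢
    field_simp
    linear_combination (u + ((N : ℚ) + 1) * (N + 2)) * (N + 2) * ih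

lemma factorial_sq_mul_weightSum (u : ℚ) (N : ℕ) :
    ((N + 1).factorial : ℚ) ^ 2 * weightSum u (N + 1) (N + 1) =
      u * ∏ i ∈ Finset.range N, (u + (i + 1) * (i + 2)) := by
  have h := sum_weightSum_eq_newtonSum u (n := N + 1) (by omega) (N + 1) le_rfl
  have hw := succ_mul_weightSum_succ u (N + 1) N
  have hK : newtonSum u (N + 1) (N + 1) = ((N : ℚ) + 1) *
      ∏ i ∈ Finset.range N, (u + (i + 1) * (i + 2)) / (((i : ℚ) + 1) * (i + 2)) := by
    rw [← sum_prod_ratio, Finset.mul_sum, newtonSum]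
    refine Finset.sum_congr rfl fun k hk => ?_
    rw [newtonCoeff_mul_choose u (Finset.mem_range.mp hk)]
    push_cast; rfl
  have hf := factorial_sq_mul_prod_ratio u N
  rw [hK] at h
  push_cast at h hw
  have h' := mul_left_cancel₀ (by positivity) h
  rw [h'] at hw
  have hN : (N : ℚ) + 1 ≠ 0 := by positivity
  apply mul_left_cancel₀ hN
  linear_combination ((N + 1).factorial : ℚ) ^ 2 * hw + u * hf

lemma Sval_self (l n : ℕ) :
    Sval l l n = ∑ c ∈ Finset.univ.filter (fun c : Composition n => c.length = l),
      (c.blocks.map (fun i : ℕ => (i : ℚ))).prod / (Lval c.blocks * Rval c.blocks) := by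
  refine Finset.sum_congr rfl fun c hc => ?_
  have hl : c.length = l := (Finset.mem_filter.mp hc).2
  congr 1
  have h := Multiset.powersetCard_self
    ((c.blocks.map (fun i : ℕ => (i : ℚ)) : List ℚ) : Multiset ℚ)
  rw [Multiset.coe_card, List.length_map, c.blocks_length, hl] at h
  simp [Multiset.esymm, h]

lemma eval_aeval_Pgen {n : ℕ} (hn : 1 ≤ n) (u : ℚ) :
    (MvPolynomial.aeval ![(Polynomial.X : Polynomial ℚ), 0] (Pgen n)).eval u =
      weightSum u n n := by
  have hmaps : ∀ c ∈ (Finset.univ : Finset (Composition n)), c.length ∈ Finset.Icc 1 n :=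
    fun c _ => Finset.mem_Icc.mpr ⟨c.length_pos_of_pos (by omega), c.length_le⟩
  rw [weightSum, ← Finset.sum_fiberwise_of_maps_to hmaps, Pgen, map_sum, Polynomial.eval_finsetSum]
  refine Finset.sum_congr rfl fun l _ => ?_
  rw [map_sum, Polynomial.eval_finsetSum, Finset.sum_range_succ, Finset.sum_eq_zero, zero_add]
  · simp only [map_mul, map_pow, aeval_X, algHom_C, Nat.sub_self, pow_zero, mul_one, Sval_self]
    simp only [Matrix.cons_val_zero, Polynomial.algebraMap_eq, Polynomial.eval_mul,
      Polynomial.eval_C, Polynomial.eval_pow, Polynomial.eval_X, Finset.sum_mul]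
    refine Finset.sum_congr rfl fun c hc => ?_
    rw [compositionWeight_blocks, (Finset.mem_filter.mp hc).2]
  · intro k hk
    have : l - k ≠ 0 := by have := Finset.mem_range.mp hk; omega
    simp [this]

/-- The specialization `v = 0`: `(n!)² · P_n(u,0) = u ∏_{i=1}^{n-1} (u + i(i+1))` in `ℚ[u]`. -/
theorem Pgen_at_v_zero (n : ℕ) (hn : 1 ≤ n) :
    ((n.factorial : ℚ) ^ 2) •
        (MvPolynomial.aeval ![(Polynomial.X : Polynomial ℚ), 0] (Pgen n)) =
      Polynomial.X *
        ∏ i ∈ Finset.Icc 1 (n - 1),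
          (Polynomial.X + Polynomial.C ((i : ℚ) * ((i : ℚ) + 1))) := by
  obtain ⟨N, rfl⟩ : ∃ N, n = N + 1 := ⟨n - 1, by omega⟩
  refine Polynomial.funext fun u => ?_
  rw [Polynomial.eval_smul, eval_aeval_Pgen hn, smul_eq_mul, factorial_sq_mul_weightSum,
    Polynomial.eval_mul, Polynomial.eval_X, Polynomial.eval_prod, Nat.add_sub_cancel,
    ← Finset.Ico_add_one_right_eq_Icc, Finset.prod_Ico_eq_prod_range]
  congr 1
  refine Finset.prod_congr (by simp) fun i _ => ?_
  simp
  ring
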